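/- arXiv:1504.00178 — 5 statements merged into one kernel-verified Lean document; each statement's English description precedes it below -/
import Mathlib

section
/- Let n ≥ 1, k ≥ 1 and let 1 ≤ i_1 < i_2 < ⋯ < i_k ≤ n be integers. Define integers r_1, …, r_k by r_1 = 0, r_2 = i_2 − i_1 + 2, and for s ≥ 1 (whenever the index is ≤ k): r_{2s+1} = −i_1 + 2(i_2 − i_3 + i_4 − ⋯ − i_{2s−1} + i_{2s}) − i_{2s+1} and r_{2s+2} = −i_1 + 2(i_2 − i_3 + ⋯ + i_{2s} − i_{2s+1}) + i_{2s+2} + 2. Then for all integers j, s with 0 ≤ j < s and 2s + 1 ≤ k, and every nonnegative integer p with p + 1 > i_{2s+1}, one has r_{2s+1} − r_{2j+1} ≠ 2p + 2 − i_{2j+1} − i_{2s+1} and r_{2s+1} − r_{2j+1} ≠ −(2p + 2 − i_{2j+1} − i_{2s+1}). -/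
theorem alternatingSum_succ (i : ℕ → ℤ) (s : ℕ) (hs : 1 ≤ s) :
    ∑ j ∈ Finset.Icc 2 (2 * (s + 1)), (-1 : ℤ) ^ j * i j =
      (∑ j ∈ Finset.Icc 2 (2 * s), (-1 : ℤ) ^ j * i j) - i (2 * s + 1) + i (2 * s + 2) := by
  rw [show 2 * (s + 1) = 2 * s + 1 + 1 by ring, Finset.sum_Icc_succ_top (by omega),
    Finset.sum_Icc_succ_top (by omega)]
  simp only [pow_succ, pow_mul]
  norm_num
  ring

/-- Between two even cut-offs the alternating sum of an increasing sequence grows, and by at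
most the difference of the extreme terms. -/
theorem alternatingSum_sub_bounds (k : ℕ) (i : ℕ → ℤ)
    (hmono : ∀ a b : ℕ, 1 ≤ a → a < b → b ≤ k → i a < i b) (j s : ℕ) (hj : 1 ≤ j)
    (hjs : j + 1 ≤ s) (hs : 2 * s ≤ k) :
    0 < (∑ l ∈ Finset.Icc 2 (2 * s), (-1 : ℤ) ^ l * i l)
        - ∑ l ∈ Finset.Icc 2 (2 * j), (-1 : ℤ) ^ l * i l ∧
      (∑ l ∈ Finset.Icc 2 (2 * s), (-1 : ℤ) ^ l * i l)
        - ∑ l ∈ Finset.Icc 2 (2 * j), (-1 : ℤ) ^ l * i l ≤ i (2 * s) - i (2 * j + 1) := by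
  induction s, hjs using Nat.le_induction with
  | base =>
    have h := hmono (2 * j + 1) (2 * j + 2) (by omega) (by omega) (by omega)
    rw [alternatingSum_succ i j hj, show 2 * (j + 1) = 2 * j + 2 by ring]
    constructor <;> linarith
  | succ s hjs ih =>
    obtain ⟨h1, h2⟩ := ih (by omega)
    have h3 := hmono (2 * s) (2 * s + 1) (by omega) (by omega) (by omega)
    have h4 := hmono (2 * s + 1) (2 * s + 2) (by omega) (by omega) (by omega)
    rw [alternatingSum_succ i s (by omega), show 2 * (s + 1) = 2 * s + 2 by ring]
    constructor <;> linarith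

/-- The alternating sum of an increasing sequence up to an even cut-off lies between its first
and last terms. -/
theorem alternatingSum_bounds (k : ℕ) (i : ℕ → ℤ)
    (hmono : ∀ a b : ℕ, 1 ≤ a → a < b → b ≤ k → i a < i b) (s : ℕ) (hs1 : 1 ≤ s)
    (hs : 2 * s ≤ k) :
    i 2 ≤ ∑ l ∈ Finset.Icc 2 (2 * s), (-1 : ℤ) ^ l * i l ∧
      ∑ l ∈ Finset.Icc 2 (2 * s), (-1 : ℤ) ^ l * i l ≤ i (2 * s) := by
  have hbase : ∑ l ∈ Finset.Icc 2 (2 * 1), (-1 : ℤ) ^ l * i l = i 2 := by simp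
  obtain rfl | h := hs1.eq_or_lt
  · rw [hbase]
    exact ⟨le_rfl, le_rfl⟩
  · obtain ⟨h1, h2⟩ := alternatingSum_sub_bounds k i hmono 1 s le_rfl h hs
    have h3 := hmono 2 (2 * 1 + 1) (by omega) (by omega) (by omega)
    rw [hbase] at h1 h2
    constructor <;> linarith


/-- Non-resonance of the spectral-parameter exponents attached to the
odd-position factors of an element of `𝒫⁺_ℤ(1)`: with `1 ≤ i_1 < ⋯ < i_k ≤ n` and the
integers `r_1, …, r_k` defined by `r_1 = 0`, `r_2 = i_2 − i_1 + 2`,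
`r_{2s+1} = −i_1 + 2(i_2 − i_3 + ⋯ + i_{2s}) − i_{2s+1}` and
`r_{2s+2} = −i_1 + 2(i_2 − i_3 + ⋯ − i_{2s+1}) + i_{2s+2} + 2`, for all `0 ≤ j < s` with
`2s + 1 ≤ k` and all `p ∈ ℤ≥0` with `p + 1 > i_{2s+1}` one has
`r_{2s+1} − r_{2j+1} ≠ ±(2p + 2 − i_{2j+1} − i_{2s+1})`. -/
theorem stmt0 (n k : ℕ) (hn : 1 ≤ n) (hk : 1 ≤ k) (i : ℕ → ℤ)
    (hi1 : 1 ≤ i 1) (hin : i k ≤ (n : ℤ))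
    (hmono : ∀ a b : ℕ, 1 ≤ a → a < b → b ≤ k → i a < i b)
    (r : ℕ → ℤ) (hr1 : r 1 = 0) (hr2 : 2 ≤ k → r 2 = i 2 - i 1 + 2)
    (hrodd : ∀ s : ℕ, 1 ≤ s → 2 * s + 1 ≤ k →
      r (2 * s + 1) = -i 1 + 2 * (∑ j ∈ Finset.Icc 2 (2 * s), (-1 : ℤ) ^ j * i j)
        - i (2 * s + 1))
    (hreven : ∀ s : ℕ, 1 ≤ s → 2 * s + 2 ≤ k →
      r (2 * s + 2) = -i 1 + 2 * (∑ j ∈ Finset.Icc 2 (2 * s + 1), (-1 : ℤ) ^ j * i j)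
        + i (2 * s + 2) + 2) :
    ∀ j s : ℕ, j < s → 2 * s + 1 ≤ k → ∀ p : ℕ, (p : ℤ) + 1 > i (2 * s + 1) →
      r (2 * s + 1) - r (2 * j + 1) ≠ 2 * p + 2 - i (2 * j + 1) - i (2 * s + 1) ∧
      r (2 * s + 1) - r (2 * j + 1) ≠ -(2 * p + 2 - i (2 * j + 1) - i (2 * s + 1)) := by
  intro j s hjs hs p hp
  have hlast := hmono (2 * s) (2 * s + 1) (by omega) (by omega) hs
  rw [hrodd s (by omega) hs]
  obtain rfl | hj := Nat.eq_zero_or_pos j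
  · obtain ⟨h1, h2⟩ := alternatingSum_bounds k i hmono s (by omega) (by omega)
    have h12 := hmono 1 2 le_rfl (by omega) (by omega)
    rw [show 2 * 0 + 1 = 1 from rfl, hr1]
    constructor <;> intro h <;> linarith
  · obtain ⟨h1, h2⟩ := alternatingSum_sub_bounds k i hmono j s hj hjs (by omega)
    rw [hrodd j hj (by omega)]
    constructor <;> intro h <;> linarith
end

section
/- Let n ≥ 1, k ≥ 1 and let 1 ≤ i_1 < i_2 < ⋯ < i_k ≤ n be integers. Define integers r_1, …, r_k by r_1 = 0, r_2 = i_2 − i_1 + 2, and for s ≥ 1 (whenever the index is ≤ k): r_{2s+1} = −i_1 + 2(i_2 − i_3 + i_4 − ⋯ − i_{2s−1} + i_{2s}) − i_{2s+1} and r_{2s+2} = −i_1 + 2(i_2 − i_3 + ⋯ + i_{2s} − i_{2s+1}) + i_{2s+2} + 2. Then for all integers j, s with 1 ≤ j < s and 2s ≤ k, and every nonnegative integer p with p + 1 > i_{2s}, one has r_{2s} − r_{2j} ≠ 2p + 2 − i_{2j} − i_{2s} and r_{2s} − r_{2j} ≠ −(2p + 2 − i_{2j} − i_{2s}). -/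
theorem alternating_sum_Icc_succ (i : ℕ → ℤ) (m : ℕ) :
    ∑ j ∈ Finset.Icc 2 (2 * (m + 1) + 1), (-1 : ℤ) ^ j * i j =
      ∑ j ∈ Finset.Icc 2 (2 * m + 1), (-1 : ℤ) ^ j * i j + i (2 * m + 2) - i (2 * m + 3) := by
  rw [show 2 * (m + 1) + 1 = 2 * m + 1 + 1 + 1 by ring,
    Finset.sum_Icc_succ_top (by omega), Finset.sum_Icc_succ_top (by omega)]
  have h : (-1 : ℤ) ^ (2 * m) = 1 := by simp [pow_mul]
  simp only [pow_succ, h]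
  ring_nf

/-- Differences of alternating partial sums of an increasing sequence are negative, and bounded
below by the difference of their extreme terms. -/
theorem alternating_sum_Icc_bounds (i : ℕ → ℤ) (k : ℕ)
    (hmono : ∀ a b : ℕ, 1 ≤ a → a < b → b ≤ k → i a < i b) (a b : ℕ) (hab : a < b)
    (hb : 2 * b + 1 ≤ k) :
    ∑ j ∈ Finset.Icc 2 (2 * b + 1), (-1 : ℤ) ^ j * i j <
        ∑ j ∈ Finset.Icc 2 (2 * a + 1), (-1 : ℤ) ^ j * i j ∧
      i (2 * a + 2) - i (2 * b + 1) ≤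
        ∑ j ∈ Finset.Icc 2 (2 * b + 1), (-1 : ℤ) ^ j * i j -
          ∑ j ∈ Finset.Icc 2 (2 * a + 1), (-1 : ℤ) ^ j * i j := by
  induction b, hab using Nat.le_induction with
  | base =>
    have h := hmono (2 * a + 2) (2 * a + 3) (by omega) (by omega) (by omega)
    rw [alternating_sum_Icc_succ, show 2 * (a + 1) + 1 = 2 * a + 3 by ring]
    constructor <;> linarith
  | succ b hab ih =>
    obtain ⟨h₁, h₂⟩ := ih (by omega)
    have h₃ := hmono (2 * b + 1) (2 * b + 2) (by omega) (by omega) (by omega)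
    have h₄ := hmono (2 * b + 2) (2 * b + 3) (by omega) (by omega) (by omega)
    rw [alternating_sum_Icc_succ, show 2 * (b + 1) + 1 = 2 * b + 3 by ring]
    constructor <;> linarith

/-- Non-resonance of the spectral-parameter exponents attached to the
even-position factors of an element of `𝒫⁺_ℤ(1)`: with `1 ≤ i_1 < ⋯ < i_k ≤ n` and the
integers `r_1, …, r_k` defined by `r_1 = 0`, `r_2 = i_2 − i_1 + 2`,
`r_{2s+1} = −i_1 + 2(i_2 − i_3 + ⋯ + i_{2s}) − i_{2s+1}` and
`r_{2s+2} = −i_1 + 2(i_2 − i_3 + ⋯ − i_{2s+1}) + i_{2s+2} + 2`, for all `1 ≤ j < s` with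
`2s ≤ k` and all `p ∈ ℤ≥0` with `p + 1 > i_{2s}` one has
`r_{2s} − r_{2j} ≠ ±(2p + 2 − i_{2j} − i_{2s})`. -/
theorem stmt1 (n k : ℕ) (hn : 1 ≤ n) (hk : 1 ≤ k) (i : ℕ → ℤ)
    (hi1 : 1 ≤ i 1) (hin : i k ≤ (n : ℤ))
    (hmono : ∀ a b : ℕ, 1 ≤ a → a < b → b ≤ k → i a < i b)
    (r : ℕ → ℤ) (hr1 : r 1 = 0) (hr2 : 2 ≤ k → r 2 = i 2 - i 1 + 2)
    (hrodd : ∀ s : ℕ, 1 ≤ s → 2 * s + 1 ≤ k →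
      r (2 * s + 1) = -i 1 + 2 * (∑ j ∈ Finset.Icc 2 (2 * s), (-1 : ℤ) ^ j * i j)
        - i (2 * s + 1))
    (hreven : ∀ s : ℕ, 1 ≤ s → 2 * s + 2 ≤ k →
      r (2 * s + 2) = -i 1 + 2 * (∑ j ∈ Finset.Icc 2 (2 * s + 1), (-1 : ℤ) ^ j * i j)
        + i (2 * s + 2) + 2) :
    ∀ j s : ℕ, 1 ≤ j → j < s → 2 * s ≤ k → ∀ p : ℕ, (p : ℤ) + 1 > i (2 * s) →
      r (2 * s) - r (2 * j) ≠ 2 * p + 2 - i (2 * j) - i (2 * s) ∧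
      r (2 * s) - r (2 * j) ≠ -(2 * p + 2 - i (2 * j) - i (2 * s)) := by
  intro j s hj hjs hs p hp
  have hr : ∀ m : ℕ, 2 * m + 2 ≤ k → r (2 * m + 2) =
      -i 1 + 2 * (∑ j ∈ Finset.Icc 2 (2 * m + 1), (-1 : ℤ) ^ j * i j) + i (2 * m + 2) + 2 := by
    intro m hm
    rcases Nat.eq_zero_or_pos m with rfl | hm0
    · simp only [mul_zero, zero_add] at hm ⊢
      rw [hr2 hm, Finset.Icc_eq_empty (by omega), Finset.sum_empty]
      ring
    · exact hreven m hm0 hm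
  obtain ⟨a, rfl⟩ := Nat.exists_eq_add_of_le' hj
  obtain ⟨b, rfl⟩ := Nat.exists_eq_add_of_le' (hj.trans hjs.le)
  rw [mul_add_one] at hs hp
  obtain ⟨h₁, h₂⟩ := alternating_sum_Icc_bounds i k hmono a b (by omega) (by omega)
  have h₃ := hmono (2 * b + 1) (2 * b + 2) (by omega) (by omega) hs
  rw [mul_add_one, mul_add_one, hr b hs, hr a (by omega)]
  constructor <;> intro h <;> linarith
end

section
/- Let n ≥ 1, k ≥ 1 and let 1 ≤ i_1 < i_2 < ⋯ < i_k ≤ n be integers. Define integers r_1, …, r_k by r_1 = 0, r_2 = i_2 − i_1 + 2, and for s ≥ 1 (whenever the index is ≤ k): r_{2s+1} = −i_1 + 2(i_2 − i_3 + i_4 − ⋯ − i_{2s−1} + i_{2s}) − i_{2s+1} and r_{2s+2} = −i_1 + 2(i_2 − i_3 + ⋯ + i_{2s} − i_{2s+1}) + i_{2s+2} + 2. Then for all integers j, s with 2j − 1 ≤ k and 2s ≤ k, and every nonnegative integer p satisfying max{i_{2j−1}, i_{2s}} < p + 1 ≤ min{i_{2j−1} + i_{2s}, n + 1}, one has r_{2j−1}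 − r_{2s} ≠ 2 + 2p − i_{2s} − i_{2j−1}. -/
/-- The partial sums `i 1 + ∑_{1 ≤ j ≤ m} (-1) ^ j * i j`, in which the first term cancels. -/
def altSum (i : ℕ → ℤ) (m : ℕ) : ℤ :=
  i 1 + ∑ j ∈ Finset.range m, (-1 : ℤ) ^ (j + 1) * i (j + 1)

lemma altSum_zero (i : ℕ → ℤ) : altSum i 0 = i 1 := by
  simp [altSum]

lemma altSum_odd (i : ℕ → ℤ) (a : ℕ) :
    altSum i (2 * a + 1) = altSum i (2 * a) - i (2 * a + 1) := by
  simp only [altSum, Finset.sum_range_succ, pow_succ, pow_mul]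
  simp
  ring

lemma altSum_even (i : ℕ → ℤ) (a : ℕ) :
    altSum i (2 * a + 2) = altSum i (2 * a + 1) + i (2 * a + 2) := by
  simp only [altSum, Finset.sum_range_succ, pow_succ, pow_mul]
  simp
  ring

lemma sum_Icc_two_eq_altSum (i : ℕ → ℤ) (m : ℕ) :
    ∑ j ∈ Finset.Icc 2 (m + 1), (-1 : ℤ) ^ j * i j = altSum i (m + 1) := by
  induction m with
  | zero => simp [altSum]
  | succ m ih =>
    rw [Finset.sum_Icc_succ_top (by lia), ih, altSum, altSum, Finset.sum_range_succ _ (m + 1)]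
    ring

lemma altSum_even_sub_odd_le {i : ℕ → ℤ} {k : ℕ}
    (hmono : ∀ a b : ℕ, 1 ≤ a → a < b → b ≤ k → i a < i b) (b d : ℕ)
    (hk : 2 * (b + d) + 2 ≤ k) :
    altSum i (2 * (b + d) + 2) - altSum i (2 * b + 1) ≤ i (2 * (b + d) + 2) := by
  induction d with
  | zero => simp [altSum_even]
  | succ d ih =>
    have h := ih (by lia)
    have hlt := hmono (2 * (b + d) + 2) (2 * (b + d) + 3) (by lia) (by lia) (by lia)
    have ho := altSum_odd i (b + d + 1)
    have he := altSum_even i (b + d + 1)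
    simp only [mul_add, ← add_assoc, mul_one] at *
    linarith

lemma altSum_even_sub_later_odd_le {i : ℕ → ℤ} {k : ℕ}
    (hmono : ∀ a b : ℕ, 1 ≤ a → a < b → b ≤ k → i a < i b) (a d : ℕ)
    (hk : 2 * (a + d) + 1 ≤ k) :
    altSum i (2 * a) - altSum i (2 * (a + d) + 1) ≤ i (2 * (a + d) + 1) := by
  induction d with
  | zero => simp [altSum_odd]
  | succ d ih =>
    have h := ih (by lia)
    have hlt := hmono (2 * (a + d) + 1) (2 * (a + d) + 2) (by lia) (by lia) (by lia)
    have he := altSum_even i (a + d)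
    have ho := altSum_odd i (a + d + 1)
    simp only [mul_add, ← add_assoc, mul_one] at *
    linarith


/-- The Chari braid-group criterion condition guaranteeing that
`V(π) ↪ V(π^o) ⊗ V(π^e)` is the unique irreducible submodule: with `1 ≤ i_1 < ⋯ < i_k ≤ n`
and the integers `r_1, …, r_k` defined by `r_1 = 0`, `r_2 = i_2 − i_1 + 2`,
`r_{2s+1} = −i_1 + 2(i_2 − i_3 + ⋯ + i_{2s}) − i_{2s+1}` and
`r_{2s+2} = −i_1 + 2(i_2 − i_3 + ⋯ − i_{2s+1}) + i_{2s+2} + 2`, for all `j, s ≥ 1` with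
`2j − 1 ≤ k`, `2s ≤ k`, and every `p ∈ ℤ≥0` with
`max{i_{2j−1}, i_{2s}} < p + 1 ≤ min{i_{2j−1} + i_{2s}, n + 1}`, one has
`r_{2j−1} − r_{2s} ≠ 2 + 2p − i_{2s} − i_{2j−1}`. -/
theorem stmt2 (n k : ℕ) (hn : 1 ≤ n) (hk : 1 ≤ k) (i : ℕ → ℤ)
    (hi1 : 1 ≤ i 1) (hin : i k ≤ (n : ℤ))
    (hmono : ∀ a b : ℕ, 1 ≤ a → a < b → b ≤ k → i a < i b)
    (r : ℕ → ℤ) (hr1 : r 1 = 0) (hr2 : 2 ≤ k → r 2 = i 2 - i 1 + 2)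
    (hrodd : ∀ s : ℕ, 1 ≤ s → 2 * s + 1 ≤ k →
      r (2 * s + 1) = -i 1 + 2 * (∑ j ∈ Finset.Icc 2 (2 * s), (-1 : ℤ) ^ j * i j)
        - i (2 * s + 1))
    (hreven : ∀ s : ℕ, 1 ≤ s → 2 * s + 2 ≤ k →
      r (2 * s + 2) = -i 1 + 2 * (∑ j ∈ Finset.Icc 2 (2 * s + 1), (-1 : ℤ) ^ j * i j)
        + i (2 * s + 2) + 2) :
    ∀ j s : ℕ, 1 ≤ j → 1 ≤ s → 2 * j - 1 ≤ k → 2 * s ≤ k → ∀ p : ℕ,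
      max (i (2 * j - 1)) (i (2 * s)) < (p : ℤ) + 1 →
      (p : ℤ) + 1 ≤ min (i (2 * j - 1) + i (2 * s)) ((n : ℤ) + 1) →
      r (2 * j - 1) - r (2 * s) ≠ 2 + 2 * p - i (2 * s) - i (2 * j - 1) := by
  intro j s hj hs hjk hsk p hmax _ heq
  obtain ⟨a, rfl⟩ := Nat.exists_eq_add_of_le' hj
  obtain ⟨b, rfl⟩ := Nat.exists_eq_add_of_le' hs
  have hidx : 2 * (a + 1) - 1 = 2 * a + 1 := by lia
  rw [hidx] at hjk hmax heq
  rw [mul_add, mul_one] at hsk hmax heq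
  obtain ⟨hp₁, hp₂⟩ := max_lt_iff.mp hmax
  have hodd : r (2 * a + 1) = -i 1 + 2 * altSum i (2 * a) - i (2 * a + 1) := by
    rcases a with _ | a
    · simp [hr1, altSum_zero]
      ring
    · rw [hrodd (a + 1) (by lia) hjk]
      exact congrArg (fun x => -i 1 + 2 * x - i (2 * (a + 1) + 1))
        (sum_Icc_two_eq_altSum i (2 * a + 1))
  have heven : r (2 * b + 2) = -i 1 + 2 * altSum i (2 * b + 1) + i (2 * b + 2) + 2 := by
    rcases b with _ | b
    · simp [hr2 hsk, altSum]
      ring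
    · rw [hreven (b + 1) (by lia) hsk, sum_Icc_two_eq_altSum]
  rcases lt_or_ge b a with hba | hab
  · obtain ⟨d, rfl⟩ := Nat.exists_eq_add_of_lt hba
    have hle := altSum_even_sub_odd_le hmono b d (by lia)
    have hlt := hmono (2 * (b + d) + 2) (2 * (b + d + 1) + 1) (by lia) (by lia) hjk
    rw [show 2 * (b + d + 1) = 2 * (b + d) + 2 by ring] at *
    linarith
  · obtain ⟨d, rfl⟩ := Nat.exists_eq_add_of_le hab
    have hle := altSum_even_sub_later_odd_le hmono a d (by lia)
    have hlt := hmono (2 * (a + d) + 1) (2 * (a + d) + 2) (by lia) (by lia) hsk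
    linarith
end

section
/- For every λ ∈ P⁺(1) and every ν ∈ P⁺ there exists w ∈ W̃ such that w(ν + λ^o + Λ_0) ∈ P̂⁺ and w(ν + λ^e + Λ_0) ∈ P̂⁺. -/
open Finset

/-- `P̂`, the free ℤ-module with basis `Λ_0, …, Λ_n, δ`: the first component records the
coefficients of the `Λ_i`, the second the coefficient of `δ`. -/
abbrev PHat (n : ℕ) : Type := (Fin (n + 1) → ℤ) × ℤ

/-- The fundamental affine weight `Λ_i`. -/
def Lam (n : ℕ) (i : Fin (n + 1)) : PHat n := (fun j => if j = i then 1 else 0, 0)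

/-- The null root `δ`. -/
def deltaA (n : ℕ) : PHat n := (0, 1)

/-- The simple affine root `α_i = 2Λ_i − Λ_{i−1} − Λ_{i+1} + δ_{i,0}·δ` (indices mod `n+1`). -/
def alphaA (n : ℕ) (i : Fin (n + 1)) : PHat n :=
  2 • Lam n i - Lam n (i - 1) - Lam n (i + 1) + (if i = 0 then deltaA n else 0)

/-- The simple affine reflection `s_i(x) = x − ⟨x, h_i⟩ α_i`, as an element of the
monoid of self-maps of `P̂` under composition. -/
def sA (n : ℕ) (i : Fin (n + 1)) : Function.End (PHat n) :=
  fun x => x - x.1 i • alphaA n i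

/-- The diagram rotation `τ`: `τ(Λ_j) = Λ_{j+1 (mod n+1)}`, `τ(δ) = δ`. -/
def tauA (n : ℕ) : Function.End (PHat n) :=
  fun x => (fun j => x.1 (j - 1), x.2)

/-- The extended affine Weyl group `W̃`, the group of transformations of `P̂` generated by
`s_0, …, s_n` and `τ` (as a submonoid of `Function.End (P̂)`; since each `s_i` is an
involution and `τ` has order `n+1`, this closure is a group). -/
def Wtilde (n : ℕ) : Submonoid (Function.End (PHat n)) :=
  Submonoid.closure ({tauA n} ∪ Set.range (sA n))

/-- The affine Weyl group `Ŵ`, generated by the `s_i` alone. -/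
def What (n : ℕ) : Submonoid (Function.End (PHat n)) :=
  Submonoid.closure (Set.range (sA n))

/-- The dominant affine weights `P̂⁺ = {x : ⟨x, h_i⟩ ≥ 0 for all i}`. -/
def PHatPos (n : ℕ) : Set (PHat n) := {x | ∀ i : Fin (n + 1), 0 ≤ x.1 i}

/-- The finite fundamental weight `ω_i = Λ_i − Λ_0` (1-based, `ω_0 = ω_{n+1} = 0`). -/
def omegaA (n : ℕ) (i : ℕ) : PHat n :=
  if h : 1 ≤ i ∧ i ≤ n then Lam n ⟨i, by omega⟩ - Lam n 0 else 0

/-- The differences `a_{j-1} − a_j` (indices mod `n+1`): the coefficients of the level zero weight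
with `ε`-coordinates `a`. -/
def cyclicDiff (n : ℕ) : (Fin (n + 1) → ℤ) →+ (Fin (n + 1) → ℤ) where
  toFun a j := a (j - 1) - a j
  map_zero' := by ext; simp
  map_add' a b := by ext; simp only [Pi.add_apply]; ring

/-- The `Λ`-coefficients of the level one weight with `ε`-coordinates `a`. -/
def levelOne (n : ℕ) (a : Fin (n + 1) → ℤ) : Fin (n + 1) → ℤ :=
  cyclicDiff n a + (Lam n 0).1

lemma levelOne_apply (n : ℕ) (a : Fin (n + 1) → ℤ) (j : Fin (n + 1)) :
    levelOne n a j = a (j - 1) - a j + if j = 0 then 1 else 0 := rfl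

/-- A self-map of `ε`-coordinates is realized if an element of `W̃` induces it on weights of
level one. -/
def IsRealized (n : ℕ) (g : (Fin (n + 1) → ℤ) → (Fin (n + 1) → ℤ)) : Prop :=
  ∃ w ∈ Wtilde n, ∀ (x : PHat n) (a : Fin (n + 1) → ℤ),
    x.1 = levelOne n a → (w x).1 = levelOne n (g a)

lemma IsRealized.id (n : ℕ) : IsRealized n fun a => a :=
  ⟨1, one_mem _, fun _ _ h => h⟩

lemma IsRealized.comp {n : ℕ} {f g : (Fin (n + 1) → ℤ) → (Fin (n + 1) → ℤ)}
    (hf : IsRealized n f) (hg : IsRealized n g) : IsRealized n fun a => f (g a) := by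
  obtain ⟨v, hv, hvf⟩ := hf
  obtain ⟨w, hw, hwg⟩ := hg
  exact ⟨v * w, mul_mem hv hw, fun x a h => hvf _ _ (hwg x a h)⟩

lemma alphaA_fst (n : ℕ) (i : Fin (n + 1)) :
    (alphaA n i).1 = -cyclicDiff n (Pi.single i 1 - Pi.single (i - 1) 1) := by
  have h1 (j : Fin (n + 1)) : j - 1 = i ↔ j = i + 1 := sub_eq_iff_eq_add
  have h2 (j : Fin (n + 1)) : j - 1 = i - 1 ↔ j = i := sub_left_inj
  ext j
  have hδ : (if i = 0 then deltaA n else 0).1 = 0 := by split_ifs <;> rfl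
  simp only [alphaA, Prod.fst_add, hδ]
  simp only [Lam, cyclicDiff, Pi.single_apply, AddMonoidHom.coe_mk, ZeroHom.coe_mk, Pi.neg_apply,
    Pi.sub_apply, Pi.add_apply, Prod.fst_sub, Prod.fst_add, Pi.zero_apply, h1, h2, two_smul]
  ring

lemma isRealized_reflection (n : ℕ) (i : Fin (n + 1)) :
    IsRealized n fun a => a + levelOne n a i • (Pi.single i 1 - Pi.single (i - 1) 1) := by
  refine ⟨sA n i, Submonoid.subset_closure (Or.inr ⟨i, rfl⟩), fun x a h => ?_⟩
  change x.1 - x.1 i • (alphaA n i).1 = _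
  rw [alphaA_fst, h]
  simp only [levelOne, map_add, map_zsmul]
  module

lemma isRealized_rotation (n : ℕ) :
    IsRealized n fun a j => a (j - 1) + if j = 0 then 1 else 0 := by
  refine ⟨tauA n, Submonoid.subset_closure (Or.inl rfl), fun x a h => ?_⟩
  ext j
  change x.1 (j - 1) = _
  rw [h, levelOne_apply, levelOne_apply]
  ring

lemma isRealized_adjacent_swap (n : ℕ) (i : Fin n) :
    IsRealized n fun a => a ∘ Equiv.swap i.castSucc i.succ := by
  have hpred : i.succ - 1 = i.castSucc := by
    rw [sub_eq_iff_eq_add, Fin.coeSucc_eq_succ]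
  have hne : i.castSucc ≠ i.succ := i.castSucc_lt_succ.ne
  convert isRealized_reflection n i.succ using 2 with a
  ext j
  simp only [levelOne_apply, hpred, Fin.succ_ne_zero, if_false, Function.comp_apply, Pi.add_apply,
    Pi.smul_apply, Pi.sub_apply, Pi.single_apply, Equiv.swap_apply_def, smul_eq_mul]
  split_ifs <;> simp_all

lemma isRealized_perm (n : ℕ) (σ : Equiv.Perm (Fin (n + 1))) :
    IsRealized n fun a => a ∘ σ := by
  have hσ : σ ∈ Submonoid.closure
      (Set.range fun i : Fin n => Equiv.swap i.castSucc i.succ) := by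
    rw [Equiv.Perm.mclosure_swap_castSucc_succ]
    trivial
  induction hσ using Submonoid.closure_induction with
  | mem _ h =>
    obtain ⟨i, rfl⟩ := h
    exact isRealized_adjacent_swap n i
  | one => exact IsRealized.id n
  | mul σ ρ _ _ hσ hρ => exact hρ.comp hσ

lemma isRealized_translation_single (n : ℕ) (p : Fin (n + 1)) :
    IsRealized n fun a => a + Pi.single p 1 := by
  have hzero : IsRealized n fun a => a + Pi.single 0 1 := by
    convert (isRealized_rotation n).comp (isRealized_perm n (Equiv.addRight 1)) using 2 with a
    ext j
    simp [Pi.single_apply]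
  convert (isRealized_perm n (Equiv.swap 0 p)).comp
    (hzero.comp (isRealized_perm n (Equiv.swap 0 p))) using 2 with a
  ext j
  simp [Pi.single_apply, Equiv.swap_apply_eq_iff]

lemma isRealized_translation (n : ℕ) (v : Fin (n + 1) → ℕ) :
    IsRealized n fun a => a + fun p => (v p : ℤ) := by
  let T : AddSubmonoid (Fin (n + 1) → ℤ) :=
    { carrier := {u | IsRealized n fun a => a + u}
      zero_mem' := by simpa using IsRealized.id n
      add_mem' := fun {u u'} hu hu' => by simpa [add_assoc] using IsRealized.comp hu' hu }
  have hv : (fun p => (v p : ℤ)) = ∑ p, v p • (Pi.single p 1 : Fin (n + 1) → ℤ) := by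
    ext q
    simp [Finset.sum_apply, Pi.single_apply]
  have hT : (fun p => (v p : ℤ)) ∈ T := by
    rw [hv]
    exact sum_mem fun p _ => nsmul_mem (isRealized_translation_single n p) _
  exact hT

lemma levelOne_nonneg {n : ℕ} {a : Fin (n + 1) → ℤ} (hanti : Antitone a)
    (hdiff : ∀ p q, a p ≤ a q + 1) (j : Fin (n + 1)) : 0 ≤ levelOne n a j := by
  rw [levelOne_apply]
  split_ifs with hj
  · linarith [hdiff j (j - 1)]
  · have : j - 1 ≤ j := by
      obtain ⟨i, rfl⟩ := Fin.exists_succ_eq.mpr hj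
      have : i.succ - 1 = i.castSucc := by rw [sub_eq_iff_eq_add, Fin.coeSucc_eq_succ]
      rw [this]
      exact i.castSucc_lt_succ.le
    linarith [hanti this]

/-- Two level one weights whose `ε`-coordinates differ by a vector with entries in an interval of
length one can be made dominant simultaneously. -/
lemma exists_mem_Wtilde_dominant {n : ℕ} {x y : PHat n} {a b : Fin (n + 1) → ℤ}
    (hx : x.1 = levelOne n a) (hy : y.1 = levelOne n b)
    (hab : ∀ p q, a p - b p ≤ a q - b q + 1) :
    ∃ w ∈ Wtilde n, w x ∈ PHatPos n ∧ w y ∈ PHatPos n := by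
  obtain ⟨N, hN⟩ : ∃ N, ∀ p, b p ≤ N := (Set.finite_range b).bddAbove.imp fun N hN p => hN ⟨p, rfl⟩
  let σ : Equiv.Perm (Fin (n + 1)) := Tuple.sort fun p => b p - a p
  have hσ : Monotone ((fun p => b p - a p) ∘ σ) := Tuple.monotone_sort _
  have hv (p : Fin (n + 1)) : ((N - b p).toNat : ℤ) = N - b p :=
    Int.toNat_of_nonneg (sub_nonneg.mpr (hN p))
  obtain ⟨w, hw, hwg⟩ := (isRealized_perm n σ).comp
    (isRealized_translation n fun p => (N - b p).toNat)
  refine ⟨w, hw, fun j => ?_, fun j => ?_⟩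
  · rw [hwg x a hx]
    refine levelOne_nonneg (fun p q hpq => ?_) (fun p q => ?_) j
    · have := hσ hpq
      simp only [Function.comp_apply, Pi.add_apply, hv] at this ⊢
      linarith
    · simp only [Function.comp_apply, Pi.add_apply, hv]
      linarith [hab (σ p) (σ q)]
  · rw [hwg y b hy]
    refine levelOne_nonneg (fun p q _ => ?_) (fun p q => ?_) j <;>
      simp [hv]

lemma omegaA_fst (n i : ℕ) :
    (omegaA n i).1 = cyclicDiff n fun p => if (p : ℕ) < i then 1 else 0 := by
  ext j
  change _ = (if ((j - 1 : Fin (n + 1)) : ℕ) < i then (1 : ℤ) else 0) - if (j : ℕ) < i then 1 else 0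
  have hj : ((j - 1 : Fin (n + 1)) : ℕ) = if j = 0 then n else (j : ℕ) - 1 := Fin.coe_sub_one j
  rw [hj]
  have hlt := j.isLt
  by_cases h : 1 ≤ i ∧ i ≤ n
  · simp only [omegaA, h, and_self, dif_pos, Prod.fst_sub, Lam, Pi.sub_apply, Fin.ext_iff,
      Fin.val_zero]
    split_ifs <;> omega
  · simp only [omegaA, h, dif_neg, not_false_eq_true, Prod.fst_zero, Pi.zero_apply, Fin.ext_iff,
      Fin.val_zero]
    split_ifs <;> omega

/-- The `ε`-coordinates of `∑ c_i ω_i + ∑_{j ∈ s} ω_{e_j}`. -/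
def partitionCoords (n : ℕ) (c e : ℕ → ℕ) (s : Finset ℕ) (p : Fin (n + 1)) : ℤ :=
  (∑ i ∈ Finset.Icc 1 n, c i • if (p : ℕ) < i then 1 else 0) +
    ∑ j ∈ s, if (p : ℕ) < e j then 1 else 0

lemma weight_fst (n : ℕ) (c e : ℕ → ℕ) (s : Finset ℕ) :
    ((∑ i ∈ Finset.Icc 1 n, c i • omegaA n i) + (∑ j ∈ s, omegaA n (e j)) + Lam n 0).1 =
      levelOne n (partitionCoords n c e s) := by
  have h : partitionCoords n c e s =
      (∑ i ∈ Finset.Icc 1 n, c i • fun p : Fin (n + 1) => if (p : ℕ) < i then (1 : ℤ) else 0) +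
        ∑ j ∈ s, fun p : Fin (n + 1) => if (p : ℕ) < e j then (1 : ℤ) else 0 := by
    ext p
    simp [partitionCoords, Finset.sum_apply]
  rw [levelOne, h, map_add, map_sum, map_sum]
  simp only [map_nsmul, Prod.fst_add, Prod.fst_sum, Prod.smul_fst, omegaA_fst]

/-- For increasing `e`, the alternating sum `∑_j (−1)^{j+1} [p < e_j]` over `1 ≤ j ≤ k` takes, as
`p` varies, values in an interval of length one depending only on `k`. -/
lemma alternating_count_mem (k : ℕ) (e : ℕ → ℕ)
    (hmono : ∀ a b : ℕ, 1 ≤ a → a < b → b ≤ k → e a < e b) (p : ℕ) :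
    (∑ j ∈ (Finset.Icc 1 k).filter (fun j => Odd j), if p < e j then (1 : ℤ) else 0) -
        (∑ j ∈ (Finset.Icc 1 k).filter (fun j => Even j), if p < e j then (1 : ℤ) else 0) ∈
      Set.Icc (((k % 2 : ℕ) : ℤ) - 1) ((k % 2 : ℕ) : ℤ) := by
  induction k with
  | zero => simp
  | succ k ih =>
    have ih := ih fun a b ha hab hb => hmono a b ha hab (by omega)
    by_cases hp : p < e (k + 1)
    · rw [← Finset.insert_Icc_right_eq_Icc_add_one (by omega), Finset.filter_insert,
        Finset.filter_insert]
      rcases Nat.even_or_odd (k + 1) with h | h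
      · have h' : ¬ Odd (k + 1) := Nat.not_odd_iff_even.mpr h
        rw [if_pos h, if_neg h', Finset.sum_insert (by simp), if_pos hp]
        have := Nat.even_iff.mp h
        simp only [Set.mem_Icc] at ih ⊢
        omega
      · have h' : ¬ Even (k + 1) := Nat.not_even_iff_odd.mpr h
        rw [if_pos h, if_neg h', Finset.sum_insert (by simp), if_pos hp]
        have := Nat.odd_iff.mp h
        simp only [Set.mem_Icc] at ih ⊢
        omega
    · have hle (j : ℕ) (hj : j ∈ Finset.Icc 1 (k + 1)) : ¬ p < e j := by
        rw [Finset.mem_Icc] at hj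
        rcases hj.2.eq_or_lt with rfl | hlt
        · exact hp
        · have := hmono j (k + 1) hj.1 hlt le_rfl
          omega
      rw [Finset.sum_eq_zero fun j hj => if_neg (hle j (Finset.mem_filter.mp hj).1),
        Finset.sum_eq_zero fun j hj => if_neg (hle j (Finset.mem_filter.mp hj).1), Set.mem_Icc]
      omega

/-- For every `λ ∈ P⁺(1)` (written as `ω_{i_1} + ⋯ + ω_{i_k}` with
`1 ≤ i_1 < ⋯ < i_k ≤ n`, encoded by the strictly increasing index function `e`) and every
`ν ∈ P⁺` (with coefficients `c`), there exists `w ∈ W̃` with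
`w(ν + λ^o + Λ_0) ∈ P̂⁺` and `w(ν + λ^e + Λ_0) ∈ P̂⁺`. -/
theorem stmt3 (n : ℕ) (hn : 2 ≤ n) (k : ℕ) (e : ℕ → ℕ)
    (hrange : ∀ j : ℕ, 1 ≤ j → j ≤ k → 1 ≤ e j ∧ e j ≤ n)
    (hmono : ∀ a b : ℕ, 1 ≤ a → a < b → b ≤ k → e a < e b)
    (c : ℕ → ℕ) :
    ∃ w ∈ Wtilde n,
      w ((∑ i ∈ Finset.Icc 1 n, c i • omegaA n i) +
          (∑ j ∈ (Finset.Icc 1 k).filter (fun j => Odd j), omegaA n (e j)) + Lam n 0)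
        ∈ PHatPos n ∧
      w ((∑ i ∈ Finset.Icc 1 n, c i • omegaA n i) +
          (∑ j ∈ (Finset.Icc 1 k).filter (fun j => Even j), omegaA n (e j)) + Lam n 0)
        ∈ PHatPos n := by
  refine exists_mem_Wtilde_dominant (weight_fst n c e _) (weight_fst n c e _) fun p q => ?_
  have hp := alternating_count_mem k e hmono p
  have hq := alternating_count_mem k e hmono q
  rw [Set.mem_Icc] at hp hq
  simp only [partitionCoords]
  linarith [hp.2, hq.1]
end

section
/- Let λ ∈ P⁺(1). If there exists w ∈ W̃ with w(λ^o + Λ_0) ∈ P̂⁺ and w(λ^e + Λ_0) ∈ P̂⁺, then for every ν ∈ P⁺ there exists w′ ∈ W̃ with w′(ν + λ^o + Λ_0) ∈ P̂⁺ and w′(ν + λ^e + Λ_0) ∈ P̂⁺. -/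
open Finset

/-- `b` is a cyclic potential for `z`: its successive differences are `M z_i - L`. -/
def IsPotential {n : ℕ} (M L : ℤ) (z : PHat n) (b : Fin (n + 1) → ℤ) : Prop :=
  ∀ i, b i - b (i - 1) = M * z.1 i - L

namespace IsPotential

variable {n : ℕ} {M L L' : ℤ} {z z' : PHat n} {b b' : Fin (n + 1) → ℤ}

theorem zero : IsPotential M 0 (0 : PHat n) 0 := fun i => by simp

theorem add (h : IsPotential M L z b) (h' : IsPotential M L' z' b') :
    IsPotential M (L + L') (z + z') (b + b') := fun i => by
  have h1 := h i
  have h2 := h' i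
  simp only [Pi.add_apply, Prod.fst_add]
  linear_combination h1 + h2

theorem smul (a : ℤ) (h : IsPotential M L z b) : IsPotential M (a * L) (a • z) (a • b) :=
  fun i => by
    have h1 := h i
    simp only [Pi.smul_apply, Prod.smul_fst, smul_eq_mul]
    linear_combination a * h1

theorem sum {ι : Type*} (s : Finset ι) {z : ι → PHat n} {b : ι → Fin (n + 1) → ℤ}
    (h : ∀ j ∈ s, IsPotential M 0 (z j) (b j)) :
    IsPotential M 0 (∑ j ∈ s, z j) (∑ j ∈ s, b j) := by
  classical
  induction s using Finset.induction_on with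
  | empty => simpa using zero
  | insert a s ha ih =>
    rw [sum_insert ha, sum_insert ha]
    simpa using (h a (mem_insert_self a s)).add (ih fun j hj => h j (mem_insert_of_mem hj))

theorem fundamental {i : ℕ} (h1 : 1 ≤ i) (h2 : i ≤ n) :
    IsPotential M 0 (omegaA n i) (fun j => if i ≤ (j : ℕ) then M else 0) := fun j => by
  simp only [omegaA, h1, h2, and_self, dite_true, Lam, Prod.fst_sub, Pi.sub_apply,
    Fin.coe_sub_one, Fin.ext_iff, Fin.val_zero]
  split_ifs <;> omega

theorem lam_zero : IsPotential (n + 1) 1 (Lam n 0) (fun j => -(j : ℤ)) := fun j => by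
  simp only [Lam]
  by_cases hj : j = 0
  · subst hj
    simp
  · have h0 : (j : ℕ) ≠ 0 := fun h => hj (Fin.ext h)
    simp only [Fin.coe_sub_one, hj, if_false]
    omega

end IsPotential

theorem sA_fst (n : ℕ) (i j : Fin (n + 1)) (z : PHat n) :
    (sA n i z).1 j = z.1 j - z.1 i * (2 * (if j = i then 1 else 0)
      - (if j = i - 1 then 1 else 0) - (if j = i + 1 then 1 else 0)) := by
  have : (if i = 0 then deltaA n else (0 : PHat n)).1 = 0 := by
    split_ifs <;> rfl
  simp only [sA, alphaA, Lam, Prod.fst_sub, Prod.smul_fst, Prod.fst_add, this, add_zero,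
    Pi.sub_apply, Pi.smul_apply, smul_eq_mul]
  simp only [nsmul_eq_mul, Nat.cast_ofNat]

theorem IsPotential.apply_sA {n : ℕ} (hn : 2 ≤ n) {M L : ℤ} {z : PHat n} {b : Fin (n + 1) → ℤ}
    (h : IsPotential M L z b) (i : Fin (n + 1)) :
    IsPotential M L (sA n i z)
      (Function.update (Function.update b i (b (i - 1) - L)) (i - 1) (b i + L)) := by
  have e1 : i ≠ i - 1 := fun h => by
    have := congrArg Fin.val h
    rw [Fin.coe_sub_one] at this
    have h0 := Fin.ext_iff (a := i) (b := 0)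
    simp only [Fin.val_zero] at h0
    split_ifs at this <;> grind
  have e2 : i - 1 ≠ i - 1 - 1 := fun h => e1 (sub_left_injective h)
  have e3 : i ≠ i + 1 := fun h => e1 (by rw [sub_eq_iff_eq_add.2 h])
  have e4 : i - 1 - 1 ≠ i := fun h => by
    have := congrArg Fin.val h
    rw [Fin.coe_sub_one, Fin.coe_sub_one] at this
    have h0 := Fin.ext_iff (a := i) (b := 0)
    have h1 := Fin.ext_iff (a := i - 1) (b := 0)
    rw [Fin.coe_sub_one] at h1
    simp only [Fin.val_zero] at h0 h1
    split_ifs at * <;> grind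
  have e5 : i - 1 ≠ i + 1 := fun h => e4 (by rw [h]; simp)
  intro j
  rw [sA_fst]
  have hi := h i
  by_cases j1 : j = i
  · subst j1
    simp [e1, e3]
    linear_combination -hi
  by_cases j2 : j = i - 1
  · subst j2
    have := h (i - 1)
    simp [e1.symm, e2.symm, e4, e5]
    linear_combination hi + this
  by_cases j3 : j = i + 1
  · subst j3
    have := h (i + 1)
    simp only [add_sub_cancel_right] at this
    simp [e1, e3.symm, e5.symm]
    linear_combination hi + this
  · have hj : j - 1 ≠ i := fun h => j3 (by rw [← h]; simp)
    have hj' : j - 1 ≠ i - 1 := fun h => j1 (sub_left_injective h)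
    simp [j1, j2, j3, hj, hj', h j]

theorem IsPotential.apply_tauA {n : ℕ} {M L : ℤ} {z : PHat n} {b : Fin (n + 1) → ℤ}
    (h : IsPotential M L z b) : IsPotential M L (tauA n z) (fun j => b (j - 1)) :=
  fun j => h (j - 1)

theorem sA_add (n : ℕ) (i : Fin (n + 1)) (x y : PHat n) :
    sA n i (x + y) = sA n i x + sA n i y := by
  simp only [sA, Prod.fst_add, Pi.add_apply, add_smul]
  abel

theorem Wtilde_map_add {n : ℕ} {w : Function.End (PHat n)} (hw : w ∈ Wtilde n) :
    ∀ x y : PHat n, w (x + y) = w x + w y := by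
  induction hw using Submonoid.closure_induction with
  | mem w hw =>
    rcases hw with rfl | ⟨i, rfl⟩
    · exact fun x y => rfl
    · exact sA_add n i
  | one => exact fun x y => rfl
  | mul f g _ _ hf hg =>
    intro x y
    change f (g (x + y)) = f (g x) + f (g y)
    rw [hg, hf]

/-- `z` has integer coordinates forming the differences of a cyclic `{0, 1}`-sequence. -/
def HasBinaryPotential {n : ℕ} (z : PHat n) : Prop :=
  ∃ b : Fin (n + 1) → ℤ, IsPotential 1 0 z b ∧ ∀ j, 0 ≤ b j ∧ b j ≤ 1

theorem HasBinaryPotential.apply_mem_Wtilde {n : ℕ} (hn : 2 ≤ n)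
    {w : Function.End (PHat n)} (hw : w ∈ Wtilde n) :
    ∀ z : PHat n, HasBinaryPotential z → HasBinaryPotential (w z) := by
  induction hw using Submonoid.closure_induction with
  | mem w hw =>
    rintro z ⟨b, hb, hb'⟩
    rcases hw with rfl | ⟨i, rfl⟩
    · exact ⟨_, hb.apply_tauA, fun j => hb' _⟩
    · refine ⟨_, hb.apply_sA hn i, fun j => ?_⟩
      have h1 := hb' i
      have h2 := hb' (i - 1)
      have h3 := hb' j
      simp only [Function.update_apply]
      split_ifs <;> simpa
  | one => exact fun z hz => hz
  | mul f g _ _ hf hg => exact fun z hz => hf _ (hg z hz)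

theorem IsPotential.sum_sq_sA_lt {n : ℕ} {M L : ℤ} (hM : 0 < M) (hL : 0 < L)
    {z : PHat n} {b : Fin (n + 1) → ℤ} (h : IsPotential M L z b) {i : Fin (n + 1)}
    (hi : z.1 i < 0) :
    ∑ j, (Function.update (Function.update b i (b (i - 1) - L)) (i - 1) (b i + L) j) ^ 2
      < ∑ j, b j ^ 2 := by
  have hne : i ≠ i - 1 := fun h' => by
    have h1 := h i
    rw [← h'] at h1
    nlinarith
  have key : ∀ f : Fin (n + 1) → ℤ,
      ∑ j, f j ^ 2 = f i ^ 2 + (f (i - 1) ^ 2 + ∑ j ∈ (univ.erase i).erase (i - 1), f j ^ 2) := by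
    intro f
    rw [add_sum_erase _ (fun j => f j ^ 2) (by simp [hne.symm]),
      add_sum_erase _ (fun j => f j ^ 2) (mem_univ i)]
  rw [key, key b]
  have hrest : ∑ j ∈ (univ.erase i).erase (i - 1),
      (Function.update (Function.update b i (b (i - 1) - L)) (i - 1) (b i + L) j) ^ 2
      = ∑ j ∈ (univ.erase i).erase (i - 1), b j ^ 2 := by
    refine sum_congr rfl fun j hj => ?_
    simp only [mem_erase] at hj
    simp [hj.1, hj.2.1]
  rw [hrest]
  simp only [Function.update_apply, hne, if_false, if_true]
  have h1 := h i
  have h2 : 0 < M * L * (-z.1 i) := by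
    have : 0 < -z.1 i := by omega
    positivity
  have h3 : L * (b i - b (i - 1)) = L * (M * z.1 i - L) := by rw [h1]
  nlinarith

/-- A weight of positive level can be moved into the dominant chamber. -/
theorem exists_mem_Wtilde_dominant_s4 {n : ℕ} (hn : 2 ≤ n) {M L : ℤ} (hM : 0 < M) (hL : 0 < L)
    (z : PHat n) (b : Fin (n + 1) → ℤ) (h : IsPotential M L z b) :
    ∃ w ∈ Wtilde n, w z ∈ PHatPos n := by
  by_cases hz : z ∈ PHatPos n
  · exact ⟨1, one_mem _, hz⟩
  · obtain ⟨i, hi⟩ : ∃ i, z.1 i < 0 := by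
      simpa [PHatPos] using hz
    have hlt := h.sum_sq_sA_lt hM hL hi
    obtain ⟨w, hw, hwz⟩ := exists_mem_Wtilde_dominant_s4 hn hM hL _ _ (h.apply_sA hn i)
    exact ⟨w * sA n i, mul_mem hw (Submonoid.subset_closure (Or.inr ⟨i, rfl⟩)), hwz⟩
termination_by (∑ j, b j ^ 2).toNat
decreasing_by
  have : 0 ≤ ∑ j, (Function.update (Function.update b i (b (i - 1) - L)) (i - 1)
    (b i + L) j) ^ 2 := sum_nonneg fun j _ => sq_nonneg _
  omega

theorem mem_PHatPos_of_add_mem {n : ℕ} {x y d : PHat n} (hd : HasBinaryPotential d)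
    (hxy : x = d + y) (h : x + y ∈ PHatPos n) : x ∈ PHatPos n ∧ y ∈ PHatPos n := by
  obtain ⟨b, hb, hb'⟩ := hd
  have key : ∀ i, 0 ≤ x.1 i ∧ 0 ≤ y.1 i := fun i => by
    have h1 := hb i
    have h2 := hb' i
    have h3 := hb' (i - 1)
    have h4 : 0 ≤ x.1 i + y.1 i := h i
    have h5 : x.1 i = d.1 i + y.1 i := by rw [hxy]; rfl
    omega
  exact ⟨fun i => (key i).1, fun i => (key i).2⟩

theorem exists_mem_Wtilde_dominant_pair {n : ℕ} (hn : 2 ≤ n) {M L : ℤ} (hM : 0 < M) (hL : 0 < L)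
    {x y d : PHat n} {b : Fin (n + 1) → ℤ} (h : IsPotential M L (x + y) b)
    (hd : HasBinaryPotential d) (hxy : x = d + y) :
    ∃ w ∈ Wtilde n, w x ∈ PHatPos n ∧ w y ∈ PHatPos n := by
  obtain ⟨w, hw, hwz⟩ := exists_mem_Wtilde_dominant_s4 hn hM hL _ _ h
  rw [Wtilde_map_add hw] at hwz
  exact ⟨w, hw, mem_PHatPos_of_add_mem (hd.apply_mem_Wtilde hn hw)
    (by rw [hxy, Wtilde_map_add hw]) hwz⟩

theorem sum_Icc_alternating (k : ℕ) :
    ∑ j ∈ Icc 1 k, (if Odd j then (1 : ℤ) else -1) = if Odd k then 1 else 0 := by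
  induction k with
  | zero => simp
  | succ k ih =>
    rw [sum_Icc_succ_top (by omega), ih]
    by_cases hk : Odd k <;> simp [hk, Nat.odd_add_one]

theorem sum_alternating_threshold_mem (k : ℕ) (e : ℕ → ℕ)
    (hmono : ∀ a b : ℕ, 1 ≤ a → a < b → b ≤ k → e a < e b) (t : ℕ) :
    0 ≤ ∑ j ∈ Icc 1 k, (if Odd j then (1 : ℤ) else -1) * (if e j ≤ t then 1 else 0) ∧
    ∑ j ∈ Icc 1 k, (if Odd j then (1 : ℤ) else -1) * (if e j ≤ t then 1 else 0) ≤ 1 := by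
  induction k with
  | zero => simp
  | succ k ih =>
    by_cases ht : e (k + 1) ≤ t
    · have : ∑ j ∈ Icc 1 (k + 1), (if Odd j then (1 : ℤ) else -1) * (if e j ≤ t then 1 else 0)
          = ∑ j ∈ Icc 1 (k + 1), (if Odd j then (1 : ℤ) else -1) := by
        refine sum_congr rfl fun j hj => ?_
        rw [mem_Icc] at hj
        have : e j ≤ t := by
          rcases hj.2.lt_or_eq with h | rfl
          · exact (hmono j (k + 1) hj.1 h le_rfl).le.trans ht
          · exact ht
        simp [this]
      rw [this, sum_Icc_alternating]
      split_ifs <;> simp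
    · rw [sum_Icc_succ_top (by omega)]
      simpa [ht] using ih fun a b ha hab hb => hmono a b ha hab (by omega)

theorem sum_sign_smul_eq_odd_sub_even {A : Type*} [AddCommGroup A] (s : Finset ℕ) (f : ℕ → A) :
    ∑ j ∈ s, (if Odd j then (1 : ℤ) else -1) • f j
      = ∑ j ∈ s.filter (fun j => Odd j), f j - ∑ j ∈ s.filter (fun j => Even j), f j := by
  rw [sum_filter, sum_filter, ← sum_sub_distrib]
  refine sum_congr rfl fun j _ => ?_
  by_cases hj : Odd j
  · simp [hj, Nat.not_even_iff_odd.2 hj]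
  · simp [hj, Nat.not_odd_iff_even.1 hj]

/-- Reduction to `ν = 0`: if for `λ ∈ P⁺(1)` some `w ∈ W̃` moves both
`λ^o + Λ_0` and `λ^e + Λ_0` into `P̂⁺`, then for every `ν ∈ P⁺` (coefficients `c`) some
`w′ ∈ W̃` moves both `ν + λ^o + Λ_0` and `ν + λ^e + Λ_0` into `P̂⁺`. -/
theorem stmt4 (n : ℕ) (hn : 2 ≤ n) (k : ℕ) (e : ℕ → ℕ)
    (hrange : ∀ j : ℕ, 1 ≤ j → j ≤ k → 1 ≤ e j ∧ e j ≤ n)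
    (hmono : ∀ a b : ℕ, 1 ≤ a → a < b → b ≤ k → e a < e b)
    (hexists : ∃ w ∈ Wtilde n,
      w ((∑ j ∈ (Finset.Icc 1 k).filter (fun j => Odd j), omegaA n (e j)) + Lam n 0)
        ∈ PHatPos n ∧
      w ((∑ j ∈ (Finset.Icc 1 k).filter (fun j => Even j), omegaA n (e j)) + Lam n 0)
        ∈ PHatPos n)
    (c : ℕ → ℕ) :
    ∃ w' ∈ Wtilde n,
      w' ((∑ i ∈ Finset.Icc 1 n, c i • omegaA n i) +
          (∑ j ∈ (Finset.Icc 1 k).filter (fun j => Odd j), omegaA n (e j)) + Lam n 0)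
        ∈ PHatPos n ∧
      w' ((∑ i ∈ Finset.Icc 1 n, c i • omegaA n i) +
          (∑ j ∈ (Finset.Icc 1 k).filter (fun j => Even j), omegaA n (e j)) + Lam n 0)
        ∈ PHatPos n := by
  have hom : ∀ (M : ℤ) (j : ℕ), j ∈ Icc 1 k → IsPotential M 0 (omegaA n (e j))
      (fun t => if e j ≤ (t : ℕ) then M else 0) := fun M j hj => by
    rw [mem_Icc] at hj
    have := hrange j hj.1 hj.2
    exact IsPotential.fundamental this.1 this.2
  have hd : HasBinaryPotential
      (∑ j ∈ Icc 1 k, (if Odd j then (1 : ℤ) else -1) • omegaA n (e j)) := by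
    refine ⟨_, IsPotential.sum _ fun j hj => by
      simpa only [mul_zero] using (hom 1 j hj).smul (if Odd j then 1 else -1), fun t => ?_⟩
    simpa only [Finset.sum_apply, Pi.smul_apply, smul_eq_mul] using sum_alternating_threshold_mem k e hmono t
  have hν := IsPotential.sum (M := n + 1) (Icc 1 n) (z := fun i => c i • omegaA n i) fun i hi => by
    rw [mem_Icc] at hi
    simpa using (IsPotential.fundamental (M := n + 1) hi.1 hi.2).smul (c i)
  have ho := IsPotential.sum (M := n + 1) ((Icc 1 k).filter fun j => Odd j) fun j hj =>
    hom (n + 1) j (mem_filter.1 hj).1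
  have he := IsPotential.sum (M := n + 1) ((Icc 1 k).filter fun j => Even j) fun j hj =>
    hom (n + 1) j (mem_filter.1 hj).1
  refine exists_mem_Wtilde_dominant_pair hn (by positivity) (by norm_num)
    (((hν.add ho).add .lam_zero).add ((hν.add he).add .lam_zero)) hd ?_
  rw [sum_sign_smul_eq_odd_sub_even]
  abel
end
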